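/- arXiv:0705.1109 — 8 statements merged into one kernel-verified Lean document; each statement's English description precedes it below -/
import Mathlib

section
/- Let E be a finite-dimensional real normed vector space, let Ω_y ⊆ E be an open convex set, and let H : E → E be injective on Ω_y and strictly (strongly Fréchet) differentiable at every point y ∈ Ω_y, with each derivative H′(y) an invertible linear map. Assume Ω_x := H(Ω_y) is convex, and assume that the variational scheme is S-monotone in the sense that ‖(H′(y))⁻¹‖ ≤ 1 for every y ∈ Ω_y (operator norm induced by the norm of E). Then the original implicit scheme is S-monotone: for all y₁, y₂ ∈ Ω_y one has ‖y₁ − y₂‖ ≤ ‖H(y₁) − H(y₂)‖; equivalently, the inverse map H⁻¹ : Ω_x → Ω_y is 1-Lipschitz. -/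
/-- for the implicit scheme `H(y) = x` on a finite-dimensional
real normed space, if `H` is injective on the open convex set `Ω_y`, strictly
Fréchet differentiable there with invertible derivatives `H′(y)`, the image
`Ω_x = H(Ω_y)` is convex, and the variational scheme is S-monotone
(`‖(H′(y))⁻¹‖ ≤ 1` for all `y ∈ Ω_y`), then the original scheme is
S-monotone: `‖y₁ − y₂‖ ≤ ‖H(y₁) − H(y₂)‖` for all `y₁, y₂ ∈ Ω_y`,
i.e. `H⁻¹` is 1-Lipschitz on `Ω_x`. -/
theorem stmt0 {E : Type*} [NormedAddCommGroup E] [NormedSpace ℝ E]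
    [FiniteDimensional ℝ E]
    (Ωy : Set E) (hopen : IsOpen Ωy) (hconv : Convex ℝ Ωy)
    (H : E → E) (H' : E → E ≃L[ℝ] E)
    (hinj : Set.InjOn H Ωy)
    (hderiv : ∀ y ∈ Ωy, HasStrictFDerivAt H (H' y : E →L[ℝ] E) y)
    (himage_conv : Convex ℝ (H '' Ωy))
    (hmono : ∀ y ∈ Ωy, ‖((H' y).symm : E →L[ℝ] E)‖ ≤ 1) :
    ∀ y₁ ∈ Ωy, ∀ y₂ ∈ Ωy, ‖y₁ - y₂‖ ≤ ‖H y₁ - H y₂‖ := by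
  have := FiniteDimensional.complete ℝ E
  have hleft : ∀ y ∈ Ωy, Function.invFunOn H Ωy (H y) = y := fun y hy =>
    hinj.leftInvOn_invFunOn hy
  have hinv : ∀ y ∈ Ωy, HasFDerivAt (Function.invFunOn H Ωy)
      ((H' y).symm : E →L[ℝ] E) (H y) := fun y hy =>
    ((hderiv y hy).to_local_left_inverse
      (Filter.mem_of_superset (hopen.mem_nhds hy) hleft)).hasFDerivAt
  intro y₁ h₁ y₂ h₂
  have hbound := himage_conv.norm_image_sub_le_of_norm_hasFDerivWithin_le
    (f := Function.invFunOn H Ωy)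
    (f' := fun x => ((H' (Function.invFunOn H Ωy x)).symm : E →L[ℝ] E)) (C := 1)
    (by
      rintro _ ⟨y, hy, rfl⟩
      simpa only [hleft y hy] using (hinv y hy).hasFDerivWithinAt)
    (by
      rintro _ ⟨y, hy, rfl⟩
      simpa only [hleft y hy] using hmono y hy)
    (Set.mem_image_of_mem H h₂) (Set.mem_image_of_mem H h₁)
  simpa only [hleft y₁ h₁, hleft y₂ h₂, one_mul] using hbound
end

section
/- Let B : ℤ × ℤ → ℝ be a family of scheme coefficients such that for each i the set {j : B(i,j) ≠ 0} is finite. Assume: (i) ∑_j B(i,j) = 1 for every i (every constant grid function is a fixed point of the scheme z(i) = ∑_j B(i,j)·y(j)); (ii) ∑_j |B(i,j)| ≤ 1 for every i (the S-monotonicity criterion); (iii) for every ∧-function y : ℤ → ℝ, the grid function z(i) = ∑_j B(i,j)·y(j) is a μ-function (GO-monotonicity). Then B(i,j) ≥ 0 for all i, j, and for every fixed m ∈ ℤ the grid function i ↦ B(i,m) is a μ-function. -/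
/-- A grid function `v : ℤ → ℝ` is a ∧-function if it increases (weakly) up
to a node `m`, with a strict increase at `m`, is constant on `[m, n]`, and
decreases (weakly) after `n`, with a strict decrease at `n + 1`. -/
def IsWedge (v : ℤ → ℝ) : Prop :=
  ∃ m n : ℤ, m ≤ n ∧
    v (m - 1) < v m ∧ (∀ i : ℤ, i < m → v (i - 1) ≤ v i) ∧
    (∀ i : ℤ, m ≤ i → i ≤ n → v i = v m) ∧
    v (n + 1) < v n ∧ (∀ i : ℤ, n < i → v (i + 1) ≤ v i)

/-- A grid function is a μ-function if it is monotone (nondecreasing or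
nonincreasing) or a ∧-function. -/
def IsMu (v : ℤ → ℝ) : Prop :=
  Monotone v ∨ Antitone v ∨ IsWedge v

/-- The unit impulse at `m` is a ∧-function. -/
theorem isWedge_single (m : ℤ) : IsWedge (Pi.single m (1 : ℝ)) := by
  refine ⟨m, m, le_rfl, ?_, ?_, ?_, ?_, ?_⟩
  · simp
  · intro i hi
    simp [hi.ne, show i - 1 ≠ m by omega]
  · intro i h₁ h₂
    rw [le_antisymm h₂ h₁]
  · simp
  · intro i hi
    simp [hi.ne', show i + 1 ≠ m by omega]

/-- A finitely supported real family whose absolute sum is at most its sum is non-negative. -/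
theorem nonneg_of_finsum_abs_le {ι : Type*} {f : ι → ℝ} (hf : (Function.support f).Finite)
    (h : ∑ᶠ j, |f j| ≤ ∑ᶠ j, f j) (j : ι) : 0 ≤ f j := by
  have habs : (Function.support fun j => |f j|).Finite :=
    hf.subset fun j hj => by simpa using hj
  have hdiff : (Function.support fun j => |f j| - f j).Finite :=
    hf.subset fun j hj h0 => hj (by simp [h0])
  have hle := single_le_finsum j hdiff fun j => sub_nonneg.2 (le_abs_self (f j))
  rw [finsum_sub_distrib habs hf] at hle
  linarith [abs_nonneg (f j)]

/-- for a scheme `z i = ∑_j B i j · y j` with finite rows such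
that (i) constants are fixed points (`∑_j B i j = 1`), (ii) the scheme is
S-monotone (`∑_j |B i j| ≤ 1`), and (iii) the scheme is GO-monotone (maps
every ∧-function to a μ-function), all coefficients are non-negative and
every column `i ↦ B i m` is a μ-function. -/
theorem stmt2 (B : ℤ → ℤ → ℝ)
    (hfin : ∀ i, (Function.support (B i)).Finite)
    (hconst : ∀ i, ∑ᶠ j, B i j = 1)
    (hS : ∀ i, ∑ᶠ j, |B i j| ≤ 1)
    (hGO : ∀ y : ℤ → ℝ, IsWedge y → IsMu (fun i => ∑ᶠ j, B i j * y j)) :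
    (∀ i j, 0 ≤ B i j) ∧ ∀ m : ℤ, IsMu (fun i => B i m) := by
  refine ⟨fun i => nonneg_of_finsum_abs_le (hfin i) ((hS i).trans_eq (hconst i).symm),
    fun m => ?_⟩
  have hcol (i : ℤ) : ∑ᶠ j, B i j * (Pi.single m (1 : ℝ) : ℤ → ℝ) j = B i m := by
    rw [finsum_eq_single _ m fun j hj => by simp [hj]]
    simp
  simpa only [hcol] using hGO _ (isWedge_single m)
end

section
/- Fix integers M ≥ 1, k_L, k_R ≥ 0 and let J_i = {j ∈ ℤ : i − k_L ≤ j ≤ i + k_R}. For each i ∈ ℤ let S_i be an invertible M×M real matrix, let λ_i¹, …, λ_iᴹ ∈ ℝ, and for j ∈ J_i let φ_{ij}(λ_iᵏ) ∈ ℝ be given scalars; set B_{ij} := S_i · diag(φ_{ij}(λ_i¹), …, φ_{ij}(λ_iᴹ)) · S_i⁻¹ for j ∈ J_i and B_{ij} := 0 otherwise. Assume: (i) max_{1≤k≤M} ∑_{j ∈ J_i} |φ_{ij}(λ_iᵏ)| ≤ 1 for every i; (ii) ‖(S_i⁻¹ − S_j⁻¹)·S_j‖_∞ ≤ Θ for every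 i and every j ∈ J_i, where Θ ≥ 0 is a constant. Then for every bounded grid function y : ℤ → ℝᴹ, the grid function z defined by z_i = ∑_{j ∈ J_i} B_{ij}·y_j satisfies sup_i ‖S_i⁻¹·z_i‖_∞ ≤ (1 + Θ)·sup_j ‖S_j⁻¹·y_j‖_∞. -/
open scoped BigOperators

attribute [local instance] Matrix.linftyOpNormedAddCommGroup

/-- The norm of a change of basis `T *ᵥ v` when `T` is close to `R⁻¹`. -/
theorem Matrix.norm_mulVec_le_of_norm_sub_mul_le {n : Type*} [Fintype n] [DecidableEq n]
    {T R P : Matrix n n ℝ} (hPR : P * R = 1) {Θ C : ℝ} (hΘ : 0 ≤ Θ)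
    (hT : ‖(T - R) * P‖ ≤ Θ) {v : n → ℝ} (hv : ‖R.mulVec v‖ ≤ C) :
    ‖T.mulVec v‖ ≤ (1 + Θ) * C := by
  have hsplit : T.mulVec v = R.mulVec v + ((T - R) * P).mulVec (R.mulVec v) := by
    rw [Matrix.mulVec_mulVec, Matrix.mul_assoc, hPR, Matrix.mul_one, ← Matrix.add_mulVec,
      add_sub_cancel]
  calc ‖T.mulVec v‖ ≤ ‖R.mulVec v‖ + ‖((T - R) * P).mulVec (R.mulVec v)‖ := by
        rw [hsplit]; exact norm_add_le _ _
    _ ≤ ‖R.mulVec v‖ + ‖(T - R) * P‖ * ‖R.mulVec v‖ := by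
        gcongr; exact Matrix.linfty_opNorm_mulVec _ _
    _ ≤ C + Θ * C := by gcongr
    _ = (1 + Θ) * C := by ring

/-- A sum of diagonal matrices with row-wise absolute sums at most one is a sup-norm
contraction. -/
theorem Matrix.norm_sum_diagonal_mulVec_le {ι n : Type*} [Fintype n] [DecidableEq n]
    (s : Finset ι) {d : ι → n → ℝ} (hd : ∀ k, ∑ j ∈ s, |d j k| ≤ 1)
    {u : ι → n → ℝ} {K : ℝ} (hK : 0 ≤ K) (hu : ∀ j ∈ s, ‖u j‖ ≤ K) :
    ‖∑ j ∈ s, (Matrix.diagonal (d j)).mulVec (u j)‖ ≤ K := by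
  refine (pi_norm_le_iff_of_nonneg hK).2 fun k => ?_
  simp only [Finset.sum_apply, Matrix.mulVec_diagonal]
  calc ‖∑ j ∈ s, d j k * u j k‖ ≤ ∑ j ∈ s, |d j k| * K := by
        refine norm_sum_le_of_le s fun j hj => ?_
        rw [norm_mul, Real.norm_eq_abs]
        gcongr
        exact (norm_le_pi_norm (u j) k).trans (hu j hj)
    _ = (∑ j ∈ s, |d j k|) * K := by rw [Finset.sum_mul]
    _ ≤ K := mul_le_of_le_one_left hK (hd k)

/-- stability estimate for one step of an explicit linear scheme
`z_i = ∑_{j ∈ J_i} B_{ij}·y_j` whose coefficient matrices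
`B_{ij} = S_i · diag(φ_{ij}(λ_i¹), …, φ_{ij}(λ_iᴹ)) · S_i⁻¹` are spectral
functions of diagonalizable matrices.  If
`max_k ∑_{j ∈ J_i} |φ_{ij}(λ_iᵏ)| ≤ 1` and
`‖(S_i⁻¹ − S_j⁻¹)·S_j‖_∞ ≤ Θ` on the stencil, then every bound `C` on
`‖S_j⁻¹·y_j‖_∞` yields `‖S_i⁻¹·z_i‖_∞ ≤ (1 + Θ)·C` for all `i`
(matrix norm: the operator norm induced by the sup norm on `ℝᴹ`). -/
theorem stmt3 (M : ℕ) (hM : 1 ≤ M) (kL kR : ℕ)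
    (S Sinv : ℤ → Matrix (Fin M) (Fin M) ℝ)
    (hS : ∀ i, S i * Sinv i = 1 ∧ Sinv i * S i = 1)
    (φ : ℤ → ℤ → Fin M → ℝ)
    (B : ℤ → ℤ → Matrix (Fin M) (Fin M) ℝ)
    (hB : ∀ i j : ℤ, j ∈ Finset.Icc (i - (kL : ℤ)) (i + (kR : ℤ)) →
      B i j = S i * Matrix.diagonal (φ i j) * Sinv i)
    (hB0 : ∀ i j : ℤ, j ∉ Finset.Icc (i - (kL : ℤ)) (i + (kR : ℤ)) → B i j = 0)
    (Θ : ℝ) (hΘ : 0 ≤ Θ)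
    (hφ : ∀ i : ℤ, ∀ k : Fin M,
      ∑ j ∈ Finset.Icc (i - (kL : ℤ)) (i + (kR : ℤ)), |φ i j k| ≤ 1)
    (hSnear : ∀ i j : ℤ, j ∈ Finset.Icc (i - (kL : ℤ)) (i + (kR : ℤ)) →
      ‖(Sinv i - Sinv j) * S j‖ ≤ Θ)
    (y : ℤ → Fin M → ℝ) (C : ℝ)
    (hy : ∀ j : ℤ, ‖(Sinv j).mulVec (y j)‖ ≤ C)
    (z : ℤ → Fin M → ℝ)
    (hz : ∀ i : ℤ, z i =
      ∑ j ∈ Finset.Icc (i - (kL : ℤ)) (i + (kR : ℤ)), (B i j).mulVec (y j)) :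
    ∀ i : ℤ, ‖(Sinv i).mulVec (z i)‖ ≤ (1 + Θ) * C := by
  intro i
  have hC : 0 ≤ C := (norm_nonneg _).trans (hy i)
  have hdiag : (Sinv i).mulVec (z i) = ∑ j ∈ Finset.Icc (i - (kL : ℤ)) (i + (kR : ℤ)),
      (Matrix.diagonal (φ i j)).mulVec ((Sinv i).mulVec (y j)) := by
    rw [hz, Matrix.mulVec_sum]
    refine Finset.sum_congr rfl fun j hj => ?_
    rw [hB i j hj, Matrix.mulVec_mulVec, Matrix.mulVec_mulVec, Matrix.mul_assoc (S i),
      ← Matrix.mul_assoc, (hS i).2, Matrix.one_mul]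
  rw [hdiag]
  exact Matrix.norm_sum_diagonal_mulVec_le _ (hφ i) (by positivity) fun j hj =>
    Matrix.norm_mulVec_le_of_norm_sub_mul_le (hS j).1 hΘ (hSnear i j hj) (hy j)
end

section
/- Fix M ≥ 1 and let S be an invertible M×M real matrix. For i, j ∈ ℤ let Φ_{ij}¹, …, Φ_{ij}ᴹ ∈ ℝ be given scalars such that for every i the set {j : (Φ_{ij}¹,…,Φ_{ij}ᴹ) ≠ 0} is finite and for every j the set {i : (Φ_{ij}¹,…,Φ_{ij}ᴹ) ≠ 0} is finite, and set B_{ij} := S · diag(Φ_{ij}¹, …, Φ_{ij}ᴹ) · S⁻¹ (so all coefficient matrices are simultaneously diagonalized by S, corresponding to pairwise commuting diagonalizable matrices A_j). Define the scheme v̂_i = ∑_{j ∈ ℤ} B_{ij}·v_j for finitely supported v : ℤ → ℝᴹ, and let h(v) := ∑_{i ∈ ℤ} ‖S⁻¹·v_i‖₁, where ‖·‖₁ is the sum of absolute values of the entries. Then h(v̂) ≤ h(v) holds for every finitely supported v (i.e. the scheme is S-monotone in the norm h) if and only if max_{1≤k≤M} ∑_{i ∈ ℤ} |Φ_{ij}ᵏ|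 ≤ 1 for every j ∈ ℤ. -/
open scoped BigOperators

/-- In the transformed variables, a simultaneously diagonalized scheme acts componentwise. -/
theorem mulVec_finsum_conj_diagonal {ι n R : Type*} [Fintype n] [DecidableEq n] [CommRing R]
    {S Sinv : Matrix n n R} (h : Sinv * S = 1) (d v : ι → n → R) {s : Finset ι}
    (hs : ∀ j ∉ s, v j = 0) (k : n) :
    Sinv.mulVec (∑ᶠ j, (S * Matrix.diagonal (d j) * Sinv).mulVec (v j)) k =
      ∑ j ∈ s, d j k * Sinv.mulVec (v j) k := by
  rw [finsum_eq_sum_of_support_subset (s := s), Matrix.mulVec_sum, Finset.sum_apply]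
  · refine Finset.sum_congr rfl fun j _ => ?_
    rw [Matrix.mulVec_mulVec, ← Matrix.mul_assoc, ← Matrix.mul_assoc, h, Matrix.one_mul,
      ← Matrix.mulVec_mulVec, Matrix.mulVec_diagonal]
  · intro j hj
    by_contra hjs
    exact hj (by simp [hs j hjs])

/-- S-monotonicity criterion for a scheme with simultaneously
diagonalizable coefficient matrices.  With
`B_{ij} = S · diag(Φ_{ij}¹, …, Φ_{ij}ᴹ) · S⁻¹` (all coefficients
diagonalized by one invertible `S`, i.e. pairwise commuting diagonalizable
`A_j`), row- and column-finite coefficients, the scheme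
`v̂_i = ∑_j B_{ij}·v_j` satisfies `h(v̂) ≤ h(v)` for every finitely
supported `v`, where `h(v) = ∑_i ‖S⁻¹·v_i‖₁`, if and only if
`max_k ∑_i |Φ_{ij}ᵏ| ≤ 1` for every `j`. -/
theorem stmt5 (M : ℕ) (hM : 1 ≤ M)
    (S Sinv : Matrix (Fin M) (Fin M) ℝ)
    (hS : S * Sinv = 1 ∧ Sinv * S = 1)
    (Φ : ℤ → ℤ → Fin M → ℝ)
    (hrow : ∀ i : ℤ, {j : ℤ | Φ i j ≠ 0}.Finite)
    (hcol : ∀ j : ℤ, {i : ℤ | Φ i j ≠ 0}.Finite) :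
    (∀ v : ℤ → Fin M → ℝ, (Function.support v).Finite →
        ∑ᶠ i : ℤ, ∑ k : Fin M,
            |Sinv.mulVec (∑ᶠ j : ℤ,
              (S * Matrix.diagonal (Φ i j) * Sinv).mulVec (v j)) k|
          ≤ ∑ᶠ i : ℤ, ∑ k : Fin M, |Sinv.mulVec (v i) k|)
      ↔ ∀ j : ℤ, ∀ k : Fin M, ∑ᶠ i : ℤ, |Φ i j k| ≤ 1 := by
  classical
  constructor
  · intro h j k
    set v : ℤ → Fin M → ℝ := Pi.single j (S.mulVec (Pi.single k 1)) with hv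
    have hv0 : ∀ j' ∉ ({j} : Finset ℤ), v j' = 0 := fun j' hj' => by
      simp [hv, Pi.single_eq_of_ne (Finset.notMem_singleton.mp hj')]
    have hvj : Sinv.mulVec (v j) = Pi.single k 1 := by
      rw [hv, Pi.single_eq_same, Matrix.mulVec_mulVec, hS.2, Matrix.one_mulVec]
    have hsum : ∀ c : Fin M → ℝ, ∑ l, |c l * (Pi.single k 1 : Fin M → ℝ) l| = |c k| := by
      intro c
      rw [Finset.sum_eq_single k] <;> simp +contextual
    have hrhs : ∑ᶠ i : ℤ, ∑ l : Fin M, |Sinv.mulVec (v i) l| = 1 := by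
      rw [finsum_eq_single _ j, hvj]
      · simpa using hsum fun _ => 1
      · intro i hi
        simp [hv0 i (by simpa using hi)]
    have hvfin : (Function.support v).Finite :=
      (Finset.finite_toSet {j}).subset fun i hi => by
        by_contra hij
        exact hi (hv0 i hij)
    simpa only [mulVec_finsum_conj_diagonal hS.2 _ v hv0, Finset.sum_singleton, hvj, hsum, hrhs]
      using h v hvfin
  · intro h v hv
    set s := hv.toFinset with hs
    have hv0 : ∀ j ∉ s, v j = 0 := fun j hj => by simpa [hs] using hj
    set t := s.biUnion fun j => (hcol j).toFinset with ht
    have hΦ : ∀ j ∈ s, ∀ i ∉ t, Φ i j = 0 := by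
      intro j hj i hi
      by_contra hij
      exact hi (Finset.mem_biUnion.mpr ⟨j, hj, by simpa using hij⟩)
    have hΦ_sum : ∀ j ∈ s, ∀ k, ∑ i ∈ t, |Φ i j k| ≤ 1 := by
      intro j hj k
      rw [← finsum_eq_sum_of_support_subset]
      · exact h j k
      · intro i hi
        by_contra hit
        exact hi (by simp [hΦ j hj i hit])
    simp only [mulVec_finsum_conj_diagonal hS.2 _ v hv0]
    rw [finsum_eq_sum_of_support_subset (s := t), finsum_eq_sum_of_support_subset (s := s)]
    · calc
        ∑ i ∈ t, ∑ k, |∑ j ∈ s, Φ i j k * Sinv.mulVec (v j) k|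
          ≤ ∑ i ∈ t, ∑ k, ∑ j ∈ s, |Φ i j k| * |Sinv.mulVec (v j) k| := by
            simp only [← abs_mul]
            gcongr
            exact Finset.abs_sum_le_sum_abs _ _
        _ = ∑ j ∈ s, ∑ k, (∑ i ∈ t, |Φ i j k|) * |Sinv.mulVec (v j) k| := by
            simp only [Finset.sum_mul]
            rw [Finset.sum_comm, Finset.sum_comm (s := s)]
            exact Finset.sum_congr rfl fun k _ => Finset.sum_comm
        _ ≤ ∑ j ∈ s, ∑ k, |Sinv.mulVec (v j) k| :=
            Finset.sum_le_sum fun j hj => Finset.sum_le_sum fun k _ =>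
              mul_le_of_le_one_left (abs_nonneg _) (hΦ_sum j hj k)
    · intro j hj
      by_contra hjs
      exact hj (by simp [hv0 j hjs])
    · intro i hi
      by_contra hit
      refine hi (Finset.sum_eq_zero fun k _ => ?_)
      rw [Finset.sum_eq_zero fun j hj => by simp [hΦ j hj i hit], abs_zero]
end

section
/- Fix M ≥ 1, an integer m ≥ 0, and Δx, Δt > 0 with Δx ≤ μ₀Δt. For k = −m, …, m let B_k : ℝ → ℝ^{M×M} be continuous, 1-periodic matrix-valued functions such that each B_k(x) is symmetric positive semidefinite, and let y : ℝ → ℝᴹ be continuous and 1-periodic. Define ŷ(x) := ∑_{k=−m}^{m} B_k(x)·y(x + kΔx). Assume, with constants c₁, c₂ ≥ 0: (i) ‖∑_{k} B_k(x)‖₂ ≤ 1 + c₁Δx for all x (spectral norm); (ii) ‖B_k(x + kΔx) − B_k(x)‖₂ ≤ c₂Δx/(2m+1) for all x and all k. It is NOT assumed that ∑_k B_k(x) = I. Then, with ‖u‖² := ∫₀¹ |u(x)|² dx (|·| the Euclidean norm on ℝᴹ), one has (1 − μ₀c₁Δt)·‖ŷ‖² ≤ (1 + μ₀(c₁ + c₂)Δt)·‖y‖²;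 in particular, for all Δt ≤ 1/(2μ₀c₁) (when c₁ > 0), ‖ŷ‖² ≤ (1 + c₃Δt)·‖y‖² with c₃ = 2μ₀(2c₁ + c₂). Hence the scheme yⁿ⁺¹ = ∑_k B_kⁿ(·)·yⁿ(· + kΔx) is stable in L², generalizing the theorem of Friedrichs to variational schemes without the partition-of-unity condition. -/
open scoped BigOperators

/-- The spectral norm `‖A‖₂` of a square real matrix: the operator norm of
the induced map on Euclidean space. -/
noncomputable def specNorm {M : ℕ} (A : Matrix (Fin M) (Fin M) ℝ) : ℝ :=
  ‖(Matrix.toEuclideanCLM (𝕜 := ℝ) A :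
      EuclideanSpace ℝ (Fin M) →L[ℝ] EuclideanSpace ℝ (Fin M))‖

open scoped Matrix

/-- The quadratic form of `A` is bounded by the spectral norm of `A`. -/
theorem dotProduct_mulVec_le_specNorm {M : ℕ} (A : Matrix (Fin M) (Fin M) ℝ) (v : Fin M → ℝ) :
    v ⬝ᵥ A *ᵥ v ≤ specNorm A * (v ⬝ᵥ v) := by
  set w : EuclideanSpace ℝ (Fin M) := WithLp.toLp 2 v with hw
  have hinner : inner ℝ w (Matrix.toEuclideanCLM (𝕜 := ℝ) A w) = v ⬝ᵥ A *ᵥ v := by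
    simp [hw, PiLp.inner_apply, dotProduct, mul_comm, Matrix.toEuclideanCLM_toLp]
  have hnorm : ‖w‖ * ‖w‖ = v ⬝ᵥ v := by
    rw [← real_inner_self_eq_norm_mul_norm, PiLp.inner_apply]
    simp [hw, dotProduct, pow_two]
  calc v ⬝ᵥ A *ᵥ v = inner ℝ w (Matrix.toEuclideanCLM (𝕜 := ℝ) A w) := hinner.symm
    _ ≤ ‖w‖ * ‖Matrix.toEuclideanCLM (𝕜 := ℝ) A w‖ := real_inner_le_norm _ _
    _ ≤ ‖w‖ * (specNorm A * ‖w‖) := by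
        gcongr
        exact ContinuousLinearMap.le_opNorm _ _
    _ = specNorm A * (v ⬝ᵥ v) := by rw [← hnorm]; ring

/-- Young's inequality for the bilinear form of a positive semidefinite matrix. -/
theorem Matrix.PosSemidef.two_mul_dotProduct_mulVec_le {n : Type*} [Fintype n]
    {A : Matrix n n ℝ} (hA : A.PosSemidef) (u v : n → ℝ) :
    2 * (u ⬝ᵥ A *ᵥ v) ≤ u ⬝ᵥ A *ᵥ u + v ⬝ᵥ A *ᵥ v := by
  have hnonneg : 0 ≤ (u - v) ⬝ᵥ A *ᵥ (u - v) := by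
    simpa using hA.dotProduct_mulVec_nonneg (u - v)
  have hsymm : v ⬝ᵥ A *ᵥ u = u ⬝ᵥ A *ᵥ v := by
    have hT : Aᵀ = A := by simpa using hA.isHermitian.eq
    rw [dotProduct_mulVec, ← mulVec_transpose, hT, dotProduct_comm]
  simp only [mulVec_sub, sub_dotProduct, dotProduct_sub] at hnonneg
  linarith

/-- The integral of a periodic function over one period is invariant under translation. -/
theorem Function.Periodic.intervalIntegral_comp_add {f : ℝ → ℝ} {T : ℝ}
    (hf : Function.Periodic f T) (a : ℝ) : ∫ x in (0 : ℝ)..T, f (x + a) = ∫ x in (0 : ℝ)..T, f x := by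
  rw [intervalIntegral.integral_comp_add_right]
  simpa [add_comm] using hf.intervalIntegral_add_eq a 0

/-- generalized Friedrichs theorem (symmetric case, without the
partition-of-unity condition `∑_k B_k = I`).  For 1-periodic continuous data
with symmetric positive semidefinite coefficients `B_k(x)`, spectral-norm
bounds `‖∑_k B_k(x)‖₂ ≤ 1 + c₁Δx` and
`‖B_k(x + kΔx) − B_k(x)‖₂ ≤ c₂Δx/(2m+1)`, and `Δx ≤ μ₀Δt`, the scheme
`ŷ(x) = ∑_{k=−m}^m B_k(x)·y(x + kΔx)` satisfies, in `L²(0,1)`,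
`(1 − μ₀c₁Δt)‖ŷ‖² ≤ (1 + μ₀(c₁ + c₂)Δt)‖y‖²`; in particular, when
`c₁ > 0` and `Δt ≤ 1/(2μ₀c₁)`, `‖ŷ‖² ≤ (1 + c₃Δt)‖y‖²` with
`c₃ = 2μ₀(2c₁ + c₂)`, i.e. the scheme is `L²`-stable. -/
theorem stmt6 (M : ℕ) (hM : 1 ≤ M) (m : ℕ)
    (Δx Δt μ₀ : ℝ) (hΔx : 0 < Δx) (hΔt : 0 < Δt) (hμ₀ : 0 < μ₀)
    (hlink : Δx ≤ μ₀ * Δt)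
    (B : ℤ → ℝ → Matrix (Fin M) (Fin M) ℝ)
    (hBcont : ∀ k : ℤ, Continuous fun x => B k x)
    (hBper : ∀ (k : ℤ) (x : ℝ), B k (x + 1) = B k x)
    (hBpsd : ∀ (k : ℤ) (x : ℝ), (B k x).PosSemidef)
    (y : ℝ → Fin M → ℝ) (hycont : Continuous y)
    (hyper : ∀ x : ℝ, y (x + 1) = y x)
    (c₁ c₂ : ℝ) (hc₁ : 0 ≤ c₁) (hc₂ : 0 ≤ c₂)
    (hB1 : ∀ x : ℝ,
      specNorm (∑ k ∈ Finset.Icc (-(m : ℤ)) (m : ℤ), B k x) ≤ 1 + c₁ * Δx)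
    (hB2 : ∀ x : ℝ, ∀ k ∈ Finset.Icc (-(m : ℤ)) (m : ℤ),
      specNorm (B k (x + (k : ℝ) * Δx) - B k x) ≤ c₂ * Δx / (2 * (m : ℝ) + 1))
    (yhat : ℝ → Fin M → ℝ)
    (hyhat : ∀ x : ℝ, yhat x =
      ∑ k ∈ Finset.Icc (-(m : ℤ)) (m : ℤ), (B k x).mulVec (y (x + (k : ℝ) * Δx))) :
    (1 - μ₀ * c₁ * Δt) * (∫ x in (0:ℝ)..1, ∑ l : Fin M, yhat x l ^ 2)
        ≤ (1 + μ₀ * (c₁ + c₂) * Δt) * (∫ x in (0:ℝ)..1, ∑ l : Fin M, y x l ^ 2)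
      ∧ (0 < c₁ → Δt ≤ 1 / (2 * μ₀ * c₁) →
          (∫ x in (0:ℝ)..1, ∑ l : Fin M, yhat x l ^ 2)
            ≤ (1 + 2 * μ₀ * (2 * c₁ + c₂) * Δt)
                * (∫ x in (0:ℝ)..1, ∑ l : Fin M, y x l ^ 2)) := by
  have hsq : ∀ v : Fin M → ℝ, ∑ l, v l ^ 2 = v ⬝ᵥ v := fun v => by simp [dotProduct, pow_two]
  simp only [hsq]
  set K := Finset.Icc (-(m : ℤ)) (m : ℤ) with hK
  have hcard : (K.card : ℝ) = 2 * (m : ℝ) + 1 := by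
    have h : K.card = 2 * m + 1 := by simp only [hK, Int.card_Icc]; omega
    rw [h]; push_cast; ring
  have hyhat_cont : Continuous yhat := by
    rw [show yhat = _ from funext hyhat]
    exact continuous_finsetSum _ fun k _ => (hBcont k).matrix_mulVec (by fun_prop)
  set d := c₂ * Δx / (2 * (m : ℝ) + 1) with hd
  set q : ℤ → ℝ → ℝ := fun k x => y x ⬝ᵥ (B k x *ᵥ y x) with hq
  have hq_cont : ∀ k, Continuous (q k) := fun k =>
    hycont.dotProduct ((hBcont k).matrix_mulVec hycont)
  have hsum : ∀ x (v : Fin M → ℝ),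
      ∑ k ∈ K, v ⬝ᵥ (B k x *ᵥ v) ≤ (1 + c₁ * Δx) * (v ⬝ᵥ v) := fun x v => by
    rw [← dotProduct_sum, ← Matrix.sum_mulVec]
    refine (dotProduct_mulVec_le_specNorm _ v).trans ?_
    have : 0 ≤ v ⬝ᵥ v := by rw [← hsq]; positivity
    gcongr
    exact hB1 x
  have hcross : ∀ x, ∀ k ∈ K, y (x + k * Δx) ⬝ᵥ (B k x *ᵥ y (x + k * Δx)) ≤
      q k (x + k * Δx) + d * (y (x + k * Δx) ⬝ᵥ y (x + k * Δx)) := fun x k hk => by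
    set v := y (x + k * Δx) with hv
    have h := dotProduct_mulVec_le_specNorm (B k x - B k (x + k * Δx)) v
    have hnorm : specNorm (B k x - B k (x + k * Δx)) ≤ d := by
      refine le_of_eq_of_le ?_ (hB2 x k hk)
      simp only [specNorm, map_sub, norm_sub_rev]
    have hv0 : 0 ≤ v ⬝ᵥ v := by rw [← hsq]; positivity
    have h' := h.trans (mul_le_mul_of_nonneg_right hnorm hv0)
    rw [Matrix.sub_mulVec, dotProduct_sub] at h'
    simp only [hq, ← hv]
    linarith
  have hpoint : ∀ x, 2 * (yhat x ⬝ᵥ yhat x) ≤ (1 + c₁ * Δx) * (yhat x ⬝ᵥ yhat x) +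
      ∑ k ∈ K, (q k (x + k * Δx) + d * (y (x + k * Δx) ⬝ᵥ y (x + k * Δx))) := fun x => by
    calc 2 * (yhat x ⬝ᵥ yhat x)
        = ∑ k ∈ K, 2 * (yhat x ⬝ᵥ (B k x *ᵥ y (x + k * Δx))) := by
          conv_lhs => rw [hyhat x, dotProduct_sum, ← hyhat x, Finset.mul_sum]
      _ ≤ ∑ k ∈ K, (yhat x ⬝ᵥ (B k x *ᵥ yhat x) +
            y (x + k * Δx) ⬝ᵥ (B k x *ᵥ y (x + k * Δx))) :=
          Finset.sum_le_sum fun k _ => (hBpsd k x).two_mul_dotProduct_mulVec_le _ _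
      _ ≤ _ := by
          rw [Finset.sum_add_distrib]
          exact add_le_add (hsum x _) (Finset.sum_le_sum (hcross x))
  have hshift_cont : ∀ k : ℤ, Continuous fun x : ℝ =>
      q k (x + k * Δx) + d * (y (x + k * Δx) ⬝ᵥ y (x + k * Δx)) := fun k => by
    have h1 : Continuous fun x : ℝ => y (x + k * Δx) := by fun_prop
    exact ((hq_cont k).comp (by fun_prop)).add (continuous_const.mul (h1.dotProduct h1))
  have hy2_cont : Continuous fun x => y x ⬝ᵥ y x := hycont.dotProduct hycont
  have hyh2_cont : Continuous fun x => yhat x ⬝ᵥ yhat x := hyhat_cont.dotProduct hyhat_cont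
  have hy2_mul : ∀ c : ℝ, Continuous fun x => c * (y x ⬝ᵥ y x) := fun c =>
    continuous_const.mul hy2_cont
  have hyh2_mul : ∀ c : ℝ, Continuous fun x => c * (yhat x ⬝ᵥ yhat x) := fun c =>
    continuous_const.mul hyh2_cont
  have hrhs_cont : Continuous fun x : ℝ =>
      ∑ k ∈ K, (q k (x + k * Δx) + d * (y (x + k * Δx) ⬝ᵥ y (x + k * Δx))) :=
    continuous_finsetSum K fun k _ => hshift_cont k
  have htotal_cont : Continuous fun x : ℝ => (1 + c₁ * Δx) * (yhat x ⬝ᵥ yhat x) +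
      ∑ k ∈ K, (q k (x + k * Δx) + d * (y (x + k * Δx) ⬝ᵥ y (x + k * Δx))) :=
    (hyh2_mul _).add hrhs_cont
  set Y := ∫ x in (0 : ℝ)..1, yhat x ⬝ᵥ yhat x with hY
  set Z := ∫ x in (0 : ℝ)..1, y x ⬝ᵥ y x with hZ
  have hshift : ∀ k : ℤ, ∫ x in (0 : ℝ)..1,
      (q k (x + k * Δx) + d * (y (x + k * Δx) ⬝ᵥ y (x + k * Δx))) =
      (∫ x in (0 : ℝ)..1, q k x) + d * Z := fun k => by
    have hper : Function.Periodic (fun x => q k x + d * (y x ⬝ᵥ y x)) 1 := fun x => by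
      simp only [hq, hBper, hyper]
    rw [hper.intervalIntegral_comp_add (k * Δx), intervalIntegral.integral_add
      ((hq_cont k).intervalIntegrable _ _)
      ((hy2_mul _).intervalIntegrable _ _),
      intervalIntegral.integral_const_mul]
  have hqsum : ∑ k ∈ K, ∫ x in (0 : ℝ)..1, q k x ≤ (1 + c₁ * Δx) * Z := by
    rw [← intervalIntegral.integral_finsetSum fun k _ => (hq_cont k).intervalIntegrable _ _,
      hZ, ← intervalIntegral.integral_const_mul]
    exact intervalIntegral.integral_mono_on zero_le_one
      ((continuous_finsetSum _ fun k _ => hq_cont k).intervalIntegrable _ _)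
      ((hy2_mul _).intervalIntegrable _ _) fun x _ => hsum x (y x)
  have hdK : ∑ k ∈ K, d * Z = c₂ * Δx * Z := by
    rw [Finset.sum_const, nsmul_eq_mul, hcard, hd]
    field_simp
  have henergy : 2 * Y ≤ (1 + c₁ * Δx) * Y + ((1 + c₁ * Δx) * Z + c₂ * Δx * Z) := by
    have hint := intervalIntegral.integral_mono_on (μ := MeasureTheory.volume)
      (zero_le_one (α := ℝ))
      ((hyh2_mul _).intervalIntegrable _ _)
      (htotal_cont.intervalIntegrable _ _)
      fun x _ => hpoint x
    rw [intervalIntegral.integral_add ((hyh2_mul _).intervalIntegrable _ _)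
      (hrhs_cont.intervalIntegrable _ _),
      intervalIntegral.integral_finsetSum fun k _ => (hshift_cont k).intervalIntegrable _ _,
      intervalIntegral.integral_const_mul, intervalIntegral.integral_const_mul] at hint
    simp only [hshift, Finset.sum_add_distrib, hdK] at hint
    linarith
  have hY0 : 0 ≤ Y := intervalIntegral.integral_nonneg zero_le_one fun x _ => by
    rw [← hsq]; positivity
  have hZ0 : 0 ≤ Z := intervalIntegral.integral_nonneg zero_le_one fun x _ => by
    rw [← hsq]; positivity
  have hmain : (1 - μ₀ * c₁ * Δt) * Y ≤ (1 + μ₀ * (c₁ + c₂) * Δt) * Z := by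
    have h1 := mul_le_mul_of_nonneg_left hlink (mul_nonneg hc₁ hY0)
    have h2 := mul_le_mul_of_nonneg_left hlink (mul_nonneg (add_nonneg hc₁ hc₂) hZ0)
    linarith
  refine ⟨hmain, fun hc₁_pos hsmall => ?_⟩
  have ha : 2 * (μ₀ * c₁ * Δt) ≤ 1 := by
    rw [le_div_iff₀ (by positivity)] at hsmall
    linarith
  have hb : 0 ≤ μ₀ * (2 * c₁ + c₂) * Δt := by positivity
  refine le_of_mul_le_mul_left (hmain.trans ?_) (by linarith : 0 < 1 - μ₀ * c₁ * Δt)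
  have h3 := mul_nonneg (mul_nonneg hb (sub_nonneg.2 ha)) hZ0
  linarith
end

section
/- Let ϰ ≥ 0, ℵ ≥ 0, r > 0 and λ_max ≥ 0. Then the monotonicity condition max over ζ ∈ [−4ℵ, 4ℵ] and λ ∈ [−λ_max, λ_max] of ( |1/2 + ϰζ/8 + (r/2)λ| + |1/2 − ϰζ/8 − (r/2)λ| ) ≤ 1 holds if and only if ϰℵ + r·λ_max ≤ 1. Thus ϰℵ + C_r ≤ 1, with Courant number C_r = Δt·λ_max/Δx and r = Δt/Δx, is necessary and sufficient for the S-monotonicity of the frozen-coefficient variational scheme of the first-order central scheme COS1, and is the stability condition of COS1. -/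
/-- with `ϰ, ℵ ≥ 0`, `r = Δt/Δx > 0`, `λ_max ≥ 0`, the
monotonicity condition
`max_{|ζ|≤4ℵ, |λ|≤λ_max} (|1/2 + ϰζ/8 + (r/2)λ| + |1/2 − ϰζ/8 − (r/2)λ|) ≤ 1`
holds iff `ϰℵ + r·λ_max ≤ 1` (i.e. `ϰℵ + C_r ≤ 1` with Courant number
`C_r = r·λ_max`): the stability/S-monotonicity condition of COS1. -/
theorem stmt13 (kappa aleph r lmax : ℝ)
    (hkappa : 0 ≤ kappa) (haleph : 0 ≤ aleph) (hr : 0 < r) (hlmax : 0 ≤ lmax) :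
    (∀ ζ ∈ Set.Icc (-(4 * aleph)) (4 * aleph), ∀ lam ∈ Set.Icc (-lmax) lmax,
        |1/2 + kappa * ζ / 8 + (r / 2) * lam| +
          |1/2 - kappa * ζ / 8 - (r / 2) * lam| ≤ 1)
      ↔ kappa * aleph + r * lmax ≤ 1 := by
  constructor
  · intro h
    have h₁ := h (4 * aleph) ⟨by linarith, le_rfl⟩ lmax ⟨by linarith, le_rfl⟩
    have h₂ := le_abs_self (1/2 + kappa * (4 * aleph) / 8 + (r / 2) * lmax)
    have h₃ := neg_le_abs (1/2 - kappa * (4 * aleph) / 8 - (r / 2) * lmax)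
    linarith
  · rintro h ζ ⟨hζ₁, hζ₂⟩ lam ⟨hlam₁, hlam₂⟩
    have h₁ := mul_le_mul_of_nonneg_left hζ₁ hkappa
    have h₂ := mul_le_mul_of_nonneg_left hζ₂ hkappa
    have h₃ := mul_le_mul_of_nonneg_left hlam₁ hr.le
    have h₄ := mul_le_mul_of_nonneg_left hlam₂ hr.le
    rw [abs_of_nonneg (by linarith), abs_of_nonneg (by linarith)]
    linarith
end

section
/- Define minmod(x, y) := (1/2)(sgn x + sgn y)·min(|x|, |y|). Let ℵ ≥ 0, let Δ₋, Δ, Δ₊, d ∈ ℝ with Δ ≠ 0, and set S₋ := 4ℵ·minmod(Δ₋, Δ), S₊ := 4ℵ·minmod(Δ, Δ₊), d̃₋ := minmod(d, S₋), d̃₊ := minmod(d, S₊). Then 0 ≤ d̃₋/Δ ≤ 4ℵ and 0 ≤ d̃₊/Δ ≤ 4ℵ. Hence the Fritsch–Carlson-type limiting procedure S_iᵏ := 4ℵ·minmod(Δ_{i−1}ᵏ, Δ_iᵏ), p̃′_iᵏ := minmod(p′_iᵏ, S_iᵏ) applied to initialized derivatives guarantees that the slope ratios α_iᵏ = p̃′_iᵏ/Δ_iᵏ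 and β_iᵏ = p̃′_{i+1}ᵏ/Δ_iᵏ lie in the monotonicity square [0, 4ℵ]. -/
/-- `minmod(x, y) = (1/2)(sgn x + sgn y)·min(|x|, |y|)`. -/
noncomputable def minmod (x y : ℝ) : ℝ :=
  (1/2) * (Real.sign x + Real.sign y) * min |x| |y|

theorem minmod_comm (x y : ℝ) : minmod x y = minmod y x := by
  simp only [minmod, add_comm, min_comm]

theorem minmod_neg_neg (x y : ℝ) : minmod (-x) (-y) = -minmod x y := by
  simp only [minmod, Real.sign_neg, abs_neg]
  ring

theorem minmod_mem_Icc_of_nonneg (x : ℝ) {y : ℝ} (hy : 0 ≤ y) :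
    minmod x y ∈ Set.Icc 0 y := by
  rcases hy.eq_or_lt with rfl | hy
  · simp [minmod]
  have hmin : 0 ≤ min |x| |y| := le_min (abs_nonneg x) (abs_nonneg y)
  have hle : min |x| |y| ≤ y := (min_le_right _ _).trans_eq (abs_of_pos hy)
  rw [minmod, Real.sign_of_pos hy]
  rcases Real.sign_apply_eq x with h | h | h <;> rw [h] <;> constructor <;> linarith

/-- Limiting by `c * s`, with `s` a value of `minmod` against `y`, bounds the ratio to `y`. -/
theorem minmod_mul_minmod_div_mem_Icc {c : ℝ} (hc : 0 ≤ c) (d x : ℝ) {y : ℝ} (hy : y ≠ 0) :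
    minmod d (c * minmod x y) / y ∈ Set.Icc 0 c := by
  wlog hpos : 0 < y generalizing d x y
  · have h := this (-d) (-x) (neg_ne_zero.mpr hy)
      (neg_pos.mpr (lt_of_le_of_ne (not_lt.mp hpos) hy))
    rwa [minmod_neg_neg, mul_neg, minmod_neg_neg, neg_div_neg_eq] at h
  obtain ⟨hs, hsy⟩ := minmod_mem_Icc_of_nonneg x hpos.le
  obtain ⟨hm, hms⟩ := minmod_mem_Icc_of_nonneg d (mul_nonneg hc hs)
  exact ⟨div_nonneg hm hpos.le,
    (div_le_iff₀ hpos).mpr (hms.trans (mul_le_mul_of_nonneg_left hsy hc))⟩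

/-- the Fritsch–Carlson-type limiting
`S₋ = 4ℵ·minmod(Δ₋, Δ)`, `S₊ = 4ℵ·minmod(Δ, Δ₊)`,
`d̃₋ = minmod(d, S₋)`, `d̃₊ = minmod(d, S₊)` forces the slope ratios
`d̃₋/Δ` and `d̃₊/Δ` into the monotonicity square `[0, 4ℵ]`. -/
theorem stmt15 (aleph : ℝ) (haleph : 0 ≤ aleph) (Δm Δ Δp d : ℝ) (hΔ : Δ ≠ 0) :
    (0 ≤ minmod d (4 * aleph * minmod Δm Δ) / Δ ∧
      minmod d (4 * aleph * minmod Δm Δ) / Δ ≤ 4 * aleph) ∧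
    (0 ≤ minmod d (4 * aleph * minmod Δ Δp) / Δ ∧
      minmod d (4 * aleph * minmod Δ Δp) / Δ ≤ 4 * aleph) := by
  have hc : 0 ≤ 4 * aleph := by positivity
  refine ⟨minmod_mul_minmod_div_mem_Icc hc d Δm hΔ, ?_⟩
  rw [minmod_comm Δ Δp]
  exact minmod_mul_minmod_div_mem_Icc hc d Δp hΔ
end

section
/- Fix 0 < ε < 1/4 and define the explicit linear scheme v̂_i = α_i·v_{i−1} + β_i·v_i + γ_i·v_{i+1} on grid functions v : ℤ → ℝ, where α_i = 1 − 2ε, β_i = γ_i = ε for i ≥ 1, and α_i = β_i = ε, γ_i = 1 − 2ε for i ≤ 0. Then: (a) all coefficients α_i, β_i, γ_i are strictly positive and α_i + β_i + γ_i = 1 for every i, so the scheme is H-monotone; (b) for the nondecreasing grid function v defined by v_i = 0 for i ≤ 0 and v_i = 1 for i ≥ 1, the output satisfies v̂_i = 0 for i < 0, v̂_0 = 1 − 2ε, v̂_1 = 2ε, and v̂_i = 1 for i > 1; (c) since v̂_{−1} = 0 < v̂_0 = 1 − 2ε and v̂_0 = 1 − 2ε > 2ε = v̂_1, the grid function v̂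 is neither nondecreasing nor nonincreasing. Hence an H-monotone scheme need not be monotonicity preserving (G-monotone). -/
/-- the H-monotone scheme
`v̂_i = α_i v_{i−1} + β_i v_i + γ_i v_{i+1}` with `α_i = 1 − 2ε`,
`β_i = γ_i = ε` for `i ≥ 1`, and `α_i = β_i = ε`, `γ_i = 1 − 2ε` for
`i ≤ 0` (where `0 < ε < 1/4`) has strictly positive coefficients summing to
one, yet maps the monotone step function `v` (`v_i = 0` for `i ≤ 0`,
`v_i = 1` for `i ≥ 1`) to a non-monotone grid function `v̂`.  Hence an
H-monotone scheme need not be monotonicity preserving (G-monotone). -/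
theorem stmt16 (ε : ℝ) (hε0 : 0 < ε) (hε4 : ε < 1/4)
    (α β γ : ℤ → ℝ)
    (hcoefpos : ∀ i : ℤ, 1 ≤ i → α i = 1 - 2 * ε ∧ β i = ε ∧ γ i = ε)
    (hcoefneg : ∀ i : ℤ, i ≤ 0 → α i = ε ∧ β i = ε ∧ γ i = 1 - 2 * ε)
    (v : ℤ → ℝ) (hv0 : ∀ i : ℤ, i ≤ 0 → v i = 0) (hv1 : ∀ i : ℤ, 1 ≤ i → v i = 1)
    (vhat : ℤ → ℝ)
    (hvhat : ∀ i : ℤ, vhat i = α i * v (i - 1) + β i * v i + γ i * v (i + 1)) :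
    (∀ i : ℤ, 0 < α i ∧ 0 < β i ∧ 0 < γ i ∧ α i + β i + γ i = 1) ∧
    ((∀ i : ℤ, i < 0 → vhat i = 0) ∧ vhat 0 = 1 - 2 * ε ∧ vhat 1 = 2 * ε ∧
      (∀ i : ℤ, 1 < i → vhat i = 1)) ∧
    Monotone v ∧ ¬ Monotone vhat ∧ ¬ Antitone vhat := by
  have hneg : ∀ i : ℤ, i < 0 → vhat i = 0 := by
    intro i hi
    rw [hvhat, hv0 (i - 1) (by omega), hv0 i (by omega), hv0 (i + 1) (by omega)]
    ring
  have hzero : vhat 0 = 1 - 2 * ε := by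
    obtain ⟨-, -, hγ⟩ := hcoefneg 0 le_rfl
    rw [hvhat, hv0 (0 - 1) (by omega), hv0 0 le_rfl, hv1 (0 + 1) (by omega), hγ]
    ring
  have hone : vhat 1 = 2 * ε := by
    obtain ⟨-, hβ, hγ⟩ := hcoefpos 1 le_rfl
    rw [hvhat, hv0 (1 - 1) (by omega), hv1 1 le_rfl, hv1 (1 + 1) (by omega), hβ, hγ]
    ring
  have hpos : ∀ i : ℤ, 1 < i → vhat i = 1 := by
    intro i hi
    obtain ⟨hα, hβ, hγ⟩ := hcoefpos i hi.le
    rw [hvhat, hv1 (i - 1) (by omega), hv1 i hi.le, hv1 (i + 1) (by omega), hα, hβ, hγ]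
    ring
  refine ⟨fun i => ?_, ⟨hneg, hzero, hone, hpos⟩, fun i j hij => ?_, fun h => ?_, fun h => ?_⟩
  · rcases le_or_gt i 0 with hi | hi
    · obtain ⟨hα, hβ, hγ⟩ := hcoefneg i hi
      rw [hα, hβ, hγ]
      refine ⟨?_, ?_, ?_, ?_⟩ <;> linarith
    · obtain ⟨hα, hβ, hγ⟩ := hcoefpos i hi
      rw [hα, hβ, hγ]
      refine ⟨?_, ?_, ?_, ?_⟩ <;> linarith
  · rcases le_or_gt i 0 with hi | hi
    · rw [hv0 i hi]
      rcases le_or_gt j 0 with hj | hj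
      · rw [hv0 j hj]
      · rw [hv1 j hj]
        exact zero_le_one
    · rw [hv1 i hi, hv1 j (by omega)]
  · have := h (show (0 : ℤ) ≤ 1 by omega)
    linarith
  · have := h (show (-1 : ℤ) ≤ 0 by omega)
    rw [hneg (-1) (by omega)] at this
    linarith
end
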